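/- arXiv:1801.10392 — 2 statements merged into one kernel-verified Lean document; each statement's English description precedes it below -/
import Mathlib

section
/- Let f be a centered continuous stationary Gaussian process on ℝ whose spectral measure μ is compactly supported and has a nontrivial absolutely continuous component (i.e., the absolutely continuous part of μ in its Lebesgue decomposition with respect to Lebesgue measure is nonzero). Then there exist constants C′ > 0 and L₀ > 0 such that for all L ≥ L₀, the probability that f(x) ≥ 0 for all x ∈ [0, L] is at least exp(−C′·L²). -/
open MeasureTheory ProbabilityTheory Real
open scoped NNReal

/-- A vector all of whose linear combinations are centered Gaussian, and whose covariance is a sum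
of two Gram matrices, is distributed as a linear image of a pair of standard Gaussians. -/
lemma map_eq_map_prod_stdGaussian {Ω : Type*} [MeasurableSpace Ω] {P : Measure Ω}
    [IsProbabilityMeasure P] {k : ℕ} {X : Fin k → Ω → ℝ} (hX : ∀ i, Measurable (X i))
    (hgauss : ∀ a : Fin k → ℝ, ∃ v : ℝ≥0, P.map (fun ω => ∑ i, a i * X i ω) = gaussianReal 0 v)
    {E F : Type*} [NormedAddCommGroup E] [InnerProductSpace ℝ E] [FiniteDimensional ℝ E]
    [MeasurableSpace E] [BorelSpace E] [NormedAddCommGroup F] [InnerProductSpace ℝ F]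
    [FiniteDimensional ℝ F] [MeasurableSpace F] [BorelSpace F] (u : Fin k → E) (v : Fin k → F)
    (hcov : ∀ i j, ∫ ω, X i ω * X j ω ∂P = inner ℝ (u i) (u j) + inner ℝ (v i) (v j)) :
    P.map (fun ω i => X i ω) = ((stdGaussian E).prod (stdGaussian F)).map
      (fun w i => inner ℝ (u i) w.1 + inner ℝ (v i) w.2) := by
  have hm1 : Measurable (fun ω i => X i ω) := measurable_pi_lambda _ hX
  have hm2 : Measurable (fun (w : E × F) (i : Fin k) =>
      inner ℝ (u i) w.1 + inner ℝ (v i) w.2) := by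
    refine measurable_pi_lambda _ fun i => ?_
    exact ((innerSL ℝ (u i)).continuous.measurable.comp measurable_fst).add
      ((innerSL ℝ (v i)).continuous.measurable.comp measurable_snd)
  have := Measure.isProbabilityMeasure_map (μ := P) hm1.aemeasurable
  have := Measure.isProbabilityMeasure_map (μ := (stdGaussian E).prod (stdGaussian F))
    hm2.aemeasurable
  have hL2 : ∀ i, MemLp (X i) 2 P := by
    intro i
    obtain ⟨v, hv⟩ := hgauss (Pi.single i 1)
    have he : (fun ω => ∑ j, (Pi.single i 1 : Fin k → ℝ) j * X j ω) = X i := by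
      ext ω; simp [Pi.single_apply]
    rw [he] at hv
    have := memLp_id_gaussianReal (μ := 0) (v := v) 2
    rw [← hv] at this
    exact (memLp_map_measure_iff (by fun_prop) (hX i).aemeasurable).1 this
  apply Measure.ext_of_charFunDual
  ext L
  set a : Fin k → ℝ := fun i => L (Pi.single i 1) with ha
  have hL : ∀ y : Fin k → ℝ, L y = ∑ i, a i * y i := by
    intro y
    conv_lhs => rw [pi_eq_sum_univ' y]
    rw [map_sum]
    refine Finset.sum_congr rfl fun i _ => ?_
    rw [map_smul, smul_eq_mul, mul_comm, ha]
  set e : E := ∑ i, a i • u i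
  set g : F := ∑ i, a i • v i
  have hsum : Measurable (fun ω => ∑ i, a i * X i ω) :=
    Finset.measurable_sum _ fun i _ => (hX i).const_mul _
  have hleft : charFunDual (P.map (fun ω i => X i ω)) L
      = Complex.exp (-(‖e‖ ^ 2 + ‖g‖ ^ 2 : ℝ) / 2) := by
    obtain ⟨s, hs⟩ := hgauss a
    have hs2 : (s : ℝ) = ‖e‖ ^ 2 + ‖g‖ ^ 2 := by
      have h1 : ∫ x, x ^ 2 ∂(gaussianReal 0 s) = s := by
        have := variance_fun_id_gaussianReal (μ := 0) (v := s)
        rw [variance_eq_integral measurable_id'.aemeasurable] at this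
        simpa using this
      rw [← hs, integral_map hsum.aemeasurable (by fun_prop)] at h1
      rw [← h1]
      have h2 : ∀ ω, (∑ i, a i * X i ω) ^ 2 = ∑ i, ∑ j, a i * a j * (X i ω * X j ω) := by
        intro ω
        rw [sq, Finset.sum_mul_sum]
        refine Finset.sum_congr rfl fun i _ => Finset.sum_congr rfl fun j _ => by ring
      have h_int : ∀ i j, Integrable (fun ω => a i * a j * (X i ω * X j ω)) P := fun i j =>
        ((hL2 i).integrable_mul (hL2 j)).const_mul _
      simp_rw [h2]
      rw [integral_finsetSum _ fun i _ => integrable_finsetSum _ fun j _ => h_int i j]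
      simp_rw [integral_finsetSum _ fun j _ => h_int _ j, integral_const_mul, hcov]
      rw [← real_inner_self_eq_norm_sq, ← real_inner_self_eq_norm_sq]
      simp only [e, g, sum_inner, inner_sum, real_inner_smul_left, real_inner_smul_right]
      rw [← Finset.sum_add_distrib]
      refine Finset.sum_congr rfl fun i _ => ?_
      rw [← Finset.sum_add_distrib]
      refine Finset.sum_congr rfl fun j _ => ?_
      rw [real_inner_comm (u j), real_inner_comm (v j)]
      ring
    rw [charFunDual_eq_charFun_map_one, Measure.map_map (by fun_prop) hm1]
    have : (L ∘ fun ω i => X i ω) = fun ω => ∑ i, a i * X i ω := by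
      ext ω; exact hL _
    rw [this, hs, charFun_gaussianReal, ← hs2]
    congr 1
    push_cast
    ring
  rw [hleft, charFunDual_apply, integral_map hm2.aemeasurable (by fun_prop)]
  have hR : ∀ w : E × F, Complex.exp ((L fun i => inner ℝ (u i) w.1 + inner ℝ (v i) w.2 : ℝ)
      * Complex.I) = Complex.exp ((inner ℝ w.1 e : ℝ) * Complex.I)
        * Complex.exp ((inner ℝ w.2 g : ℝ) * Complex.I) := by
    intro w
    rw [← Complex.exp_add, ← add_mul, hL, ← Complex.ofReal_add]
    congr 3
    simp only [e, g, inner_sum, real_inner_smul_right]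
    rw [← Finset.sum_add_distrib]
    refine Finset.sum_congr rfl fun i _ => ?_
    rw [real_inner_comm (u i), real_inner_comm (v i)]
    ring
  simp_rw [hR]
  rw [integral_prod_mul (fun x : E => Complex.exp ((inner ℝ x e : ℝ) * Complex.I))
    (fun x : F => Complex.exp ((inner ℝ x g : ℝ) * Complex.I)), ← charFun_apply, ← charFun_apply,
    charFun_stdGaussian, charFun_stdGaussian, ← Complex.exp_add]
  congr 1
  push_cast
  ring

lemma gaussianReal_Icc_ge {z δ : ℝ} (hz : |z| ≤ 1) (hδ0 : 0 ≤ δ) (hδ : δ ≤ 1) :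
    ENNReal.ofReal (δ / 20) ≤ gaussianReal 0 1 (Set.Icc (z - δ) (z + δ)) := by
  rw [gaussianReal_apply _ one_ne_zero]
  have h : ∀ x ∈ Set.Icc (z - δ) (z + δ), ENNReal.ofReal (1 / 40) ≤ gaussianPDF 0 1 x := by
    intro x hx
    apply ENNReal.ofReal_le_ofReal
    rw [gaussianPDFReal]
    have hx2 : x ^ 2 ≤ 4 := by
      have := abs_le.1 hz
      nlinarith [hx.1, hx.2]
    have h1 : √(2 * π * (1 : ℝ≥0)) ≤ 3 := by
      rw [Real.sqrt_le_left (by norm_num)]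
      have := Real.pi_lt_four
      push_cast
      linarith
    have h2 : (1 / 8 : ℝ) ≤ Real.exp (-(x - 0) ^ 2 / (2 * (1 : ℝ≥0))) := by
      have h3 : Real.exp (-2) ≤ Real.exp (-(x - 0) ^ 2 / (2 * (1 : ℝ≥0))) := by
        apply Real.exp_le_exp.2
        push_cast
        linarith
      have h4 : Real.exp 2 ≤ 8 := by
        have := Real.exp_one_lt_d9
        have h5 : Real.exp 2 = Real.exp 1 * Real.exp 1 := by rw [← Real.exp_add]; norm_num
        nlinarith [Real.exp_pos 1]
      refine le_trans ?_ h3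
      rw [Real.exp_neg, ← one_div]
      exact one_div_le_one_div_of_le (Real.exp_pos _) h4
    have h0 : 0 < √(2 * π * (1 : ℝ≥0)) := by
      apply Real.sqrt_pos.2
      have := Real.pi_pos
      push_cast
      linarith
    have h5 : (1 / 3 : ℝ) ≤ (√(2 * π * (1 : ℝ≥0)))⁻¹ := by
      rw [← one_div]
      exact one_div_le_one_div_of_le h0 h1
    nlinarith
  calc ENNReal.ofReal (δ / 20) = ∫⁻ _ in Set.Icc (z - δ) (z + δ), ENNReal.ofReal (1 / 40) := by
        rw [setLIntegral_const, Real.volume_Icc, ← ENNReal.ofReal_mul (by norm_num)]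
        congr 1
        ring
    _ ≤ _ := setLIntegral_mono' measurableSet_Icc h

lemma stdGaussian_closedBall_ge {E : Type*} [NormedAddCommGroup E] [InnerProductSpace ℝ E]
    [FiniteDimensional ℝ E] [MeasurableSpace E] [BorelSpace E] {z : E} (hz : ‖z‖ ≤ 1)
    {N : ℕ} (hN : Module.finrank ℝ E ≤ N) {δ : ℝ} (hδ0 : 0 ≤ δ) (hδ : δ ≤ 1) :
    ENNReal.ofReal ((δ / 20) ^ N) ≤ stdGaussian E (Metric.closedBall z (N * δ)) := by
  set b := stdOrthonormalBasis ℝ E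
  have hm : Measurable (fun x : Fin (Module.finrank ℝ E) → ℝ => ∑ i, x i • b i) := by fun_prop
  rw [stdGaussian, Measure.map_apply hm measurableSet_closedBall]
  have hsub : (Set.univ.pi fun i => Set.Icc (b.repr z i - δ) (b.repr z i + δ)) ⊆
      (fun x : Fin (Module.finrank ℝ E) → ℝ => ∑ i, x i • b i) ⁻¹'
        Metric.closedBall z (N * δ) := by
    intro x hx
    rw [Set.mem_preimage, Metric.mem_closedBall, dist_eq_norm]
    have h1 : ∑ i, x i • b i - z = ∑ i, (x i - b.repr z i) • b i := by
      conv_lhs => rw [← b.sum_repr z]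
      rw [← Finset.sum_sub_distrib]
      simp [sub_smul]
    rw [h1]
    calc ‖∑ i, (x i - b.repr z i) • b i‖ ≤ ∑ i : Fin (Module.finrank ℝ E), δ := by
          refine norm_sum_le_of_le _ fun i _ => ?_
          rw [norm_smul, b.norm_eq_one, mul_one, Real.norm_eq_abs, abs_le]
          have := hx i (Set.mem_univ _)
          constructor <;> linarith [this.1, this.2]
      _ = Module.finrank ℝ E * δ := by simp
      _ ≤ N * δ := by gcongr
  refine le_trans ?_ (measure_mono hsub)
  rw [Measure.pi_pi]
  calc ENNReal.ofReal ((δ / 20) ^ N)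
      ≤ ENNReal.ofReal ((δ / 20) ^ (Module.finrank ℝ E)) :=
        ENNReal.ofReal_le_ofReal (pow_le_pow_of_le_one (by positivity) (by linarith) hN)
    _ = ∏ _i : Fin (Module.finrank ℝ E), ENNReal.ofReal (δ / 20) := by
        rw [ENNReal.ofReal_pow (by positivity)]
        simp
    _ ≤ _ := by
        refine Finset.prod_le_prod' fun i _ => gaussianReal_Icc_ge ?_ hδ0 hδ
        rw [← Real.norm_eq_abs]
        exact (PiLp.norm_apply_le _ i).trans (by simpa using hz)

lemma lintegral_enorm_dual_stdGaussian_le {E : Type*} [NormedAddCommGroup E]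
    [InnerProductSpace ℝ E] [FiniteDimensional ℝ E] [MeasurableSpace E] [BorelSpace E]
    (L : StrongDual ℝ E) {s : ℝ} (hs : ‖L‖ ≤ s) :
    ∫⁻ w, ‖L w‖ₑ ∂(stdGaussian E) ≤ ENNReal.ofReal s := by
  have hL2 : MemLp L 2 (stdGaussian E) := IsGaussian.memLp_dual _ _ _ (by simp)
  have hvar : ∫ w, L w ^ 2 ∂(stdGaussian E) = ‖L‖ ^ 2 := by
    rw [← variance_dual_stdGaussian, variance_eq_integral L.continuous.aemeasurable,
      integral_strongDual_stdGaussian]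
    simp
  rcases (norm_nonneg L).eq_or_lt with h0 | h0
  · have : L = 0 := norm_eq_zero.1 h0.symm
    simp [this]
  have hL1 : Integrable L (stdGaussian E) := hL2.integrable one_le_two
  rw [← ofReal_integral_norm_eq_lintegral_enorm hL1]
  refine ENNReal.ofReal_le_ofReal (le_trans ?_ hs)
  have hle : ∀ w, ‖L w‖ ≤ (2 * ‖L‖)⁻¹ * (L w ^ 2) + ‖L‖ / 2 := by
    intro w
    rw [Real.norm_eq_abs, ← sq_abs (L w)]
    have : (2 * ‖L‖)⁻¹ * |L w| ^ 2 + ‖L‖ / 2 - |L w| = (2 * ‖L‖)⁻¹ * (|L w| - ‖L‖) ^ 2 := by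
      field_simp
      ring
    have h2 : 0 ≤ (2 * ‖L‖)⁻¹ * (|L w| - ‖L‖) ^ 2 := by positivity
    linarith
  calc ∫ w, ‖L w‖ ∂(stdGaussian E)
      ≤ ∫ w, ((2 * ‖L‖)⁻¹ * (L w ^ 2) + ‖L‖ / 2) ∂(stdGaussian E) :=
        integral_mono hL1.norm ((hL2.integrable_sq.const_mul _).add (integrable_const _)) hle
    _ = ‖L‖ := by
        rw [integral_add (hL2.integrable_sq.const_mul _) (integrable_const _),
          integral_const_mul, hvar]
        simp
        field_simp
        norm_num

/-- Lower bound for the probability that a Gaussian vector with Gram covariance is nonnegative,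
when its feature vectors are close to an `N`-dimensional space and have inner product bounded below
with a common direction. -/
lemma measure_nonneg_ge_of_gram {Ω : Type*} [MeasurableSpace Ω] {P : Measure Ω}
    [IsProbabilityMeasure P] {k : ℕ} {X : Fin k → Ω → ℝ} (hX : ∀ i, Measurable (X i))
    (hgauss : ∀ a : Fin k → ℝ, ∃ v : ℝ≥0, P.map (fun ω => ∑ i, a i * X i ω) = gaussianReal 0 v)
    {H : Type*} [NormedAddCommGroup H] [InnerProductSpace ℝ H] (φ : Fin k → H)
    (hcov : ∀ i j, ∫ ω, X i ω * X j ω ∂P = inner ℝ (φ i) (φ j))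
    {v : ℕ → H} {t : Fin k → ℕ → ℝ} {τ : ℕ → ℝ} (htτ : ∀ i n, |t i n| ≤ τ n)
    (hφ : ∀ i, HasSum (fun n => t i n • v n) (φ i)) {N : ℕ}
    (hsm : Summable fun n => τ (n + N) * ‖v (n + N)‖) {ε : ℝ} (hε : 0 < ε)
    (htail : ∑' n, τ (n + N) * ‖v (n + N)‖ ≤ ε / 2)
    {g : H} (hg : ‖g‖ ≤ 1) (hφg : ∀ i, 4 * ε ≤ inner ℝ (φ i) g) {b : ℝ}
    (hb : ∀ i, ‖φ i‖ ≤ b) {δ : ℝ} (hδ0 : 0 ≤ δ) (hδ : δ ≤ 1) (hbδ : b * (N * δ) ≤ ε) :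
    ENNReal.ofReal ((δ / 20) ^ N / 2) ≤ P {ω | ∀ i, 0 ≤ X i ω} := by
  let _ : MeasurableSpace H := borel H
  have : BorelSpace H := ⟨rfl⟩
  have hτ0 : ∀ (_ : Fin k) n, 0 ≤ τ n := fun i n => (abs_nonneg _).trans (htτ i n)
  rcases Nat.eq_zero_or_pos k with hk | hk
  · subst hk
    have : {ω | ∀ i : Fin 0, 0 ≤ X i ω} = Set.univ := by ext; simp
    rw [this, measure_univ, ENNReal.ofReal_le_one]
    have : (δ / 20) ^ N ≤ 1 := pow_le_one₀ (by positivity) (by linarith)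
    linarith
  have i0 : Fin k := ⟨0, hk⟩
  set Q : Submodule ℝ H := Submodule.span ℝ (Set.range fun i : Fin N => v i) with hQ
  have : FiniteDimensional ℝ Q := FiniteDimensional.span_of_finite ℝ (Set.finite_range _)
  have hrank : Module.finrank ℝ Q ≤ N := by
    exact (finrank_range_le_card (R := ℝ) (fun i : Fin N => v i)).trans_eq (Fintype.card_fin N)
  have hvQ : ∀ n < N, v n ∈ Q := fun n hn => Submodule.subset_span ⟨⟨n, hn⟩, rfl⟩
  set p := Q.starProjection
  set Q' : Submodule ℝ H := Submodule.span ℝ (Set.range fun i => φ i - p (φ i)) with hQ'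
  have : FiniteDimensional ℝ Q' := FiniteDimensional.span_of_finite ℝ (Set.finite_range _)
  have hQQ' : Q' ≤ Qᗮ := by
    rw [hQ', Submodule.span_le]
    rintro _ ⟨i, rfl⟩
    exact Q.sub_starProjection_mem_orthogonal _
  let x : Fin k → Q := fun i => ⟨p (φ i), Q.starProjection_apply_mem _⟩
  let y : Fin k → Q' := fun i => ⟨φ i - p (φ i), Submodule.subset_span ⟨i, rfl⟩⟩
  have hort : ∀ w ∈ Q, ∀ i, inner ℝ w (φ i - p (φ i)) = 0 := fun w hw i =>
    Submodule.inner_right_of_mem_orthogonal hw (Q.sub_starProjection_mem_orthogonal _)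
  have hmap := map_eq_map_prod_stdGaussian hX hgauss x y (by
    intro i j
    rw [hcov]
    change inner ℝ (φ i) (φ j) = inner ℝ (p (φ i)) (p (φ j))
      + inner ℝ (φ i - p (φ i)) (φ j - p (φ j))
    have h1 := hort _ (Q.starProjection_apply_mem (φ i)) j
    have h2 := hort _ (Q.starProjection_apply_mem (φ j)) i
    rw [real_inner_comm] at h2
    have h3 : φ i = p (φ i) + (φ i - p (φ i)) := by abel
    have h4 : φ j = p (φ j) + (φ j - p (φ j)) := by abel
    conv_lhs => rw [h3, h4]
    rw [inner_add_left, inner_add_right, inner_add_right]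
    change inner ℝ (p (φ i)) (φ j - p (φ j)) = 0 at h1
    change inner ℝ (φ i - p (φ i)) (p (φ j)) = 0 at h2
    rw [h1, h2]
    ring)
  have hm1 : Measurable (fun ω i => X i ω) := measurable_pi_lambda _ hX
  have hm2 : Measurable (fun (w : Q × Q') (i : Fin k) =>
      (inner ℝ (x i) w.1 + inner ℝ (y i) w.2 : ℝ)) := by
    refine measurable_pi_lambda _ fun i => ?_
    exact ((innerSL ℝ (x i)).continuous.measurable.comp measurable_fst).add
      ((innerSL ℝ (y i)).continuous.measurable.comp measurable_snd)
  have hmS : MeasurableSet {r : Fin k → ℝ | ∀ i, 0 ≤ r i} := by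
    rw [Set.ofPred_forall]
    exact MeasurableSet.iInter fun i => measurableSet_le measurable_const (measurable_pi_apply i)
  have hP : P {ω | ∀ i, 0 ≤ X i ω} = ((stdGaussian Q).prod (stdGaussian Q'))
      {w | ∀ i, (0 : ℝ) ≤ inner ℝ (x i) w.1 + inner ℝ (y i) w.2} := by
    have := congrArg (fun m => m {r : Fin k → ℝ | ∀ i, 0 ≤ r i}) hmap
    simp only [Measure.map_apply hm1 hmS, Measure.map_apply hm2 hmS] at this
    exact this
  rw [hP]
  let z : Q := ⟨p g, Q.starProjection_apply_mem _⟩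
  have hz : ‖z‖ ≤ 1 := (Q.norm_starProjection_apply_le g).trans hg
  let Z : Q' → ENNReal := fun w => ∑' n, ENNReal.ofReal (τ (n + N)) * ‖inner ℝ (v (n + N)) (w : H)‖ₑ
  have hZm : ∀ n, Measurable fun w : Q' =>
      ENNReal.ofReal (τ (n + N)) * ‖inner ℝ (v (n + N)) (w : H)‖ₑ := by
    intro n
    have : Measurable fun w : Q' => inner ℝ (v (n + N)) (w : H) :=
      ((innerSL ℝ (v (n + N))).comp Q'.subtypeL).continuous.measurable
    exact (this.enorm).const_mul _
  have hZint : ∫⁻ w, Z w ∂(stdGaussian Q') ≤ ENNReal.ofReal (ε / 2) := by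
    rw [lintegral_tsum fun n => (hZm n).aemeasurable]
    calc ∑' n, ∫⁻ w : Q', ENNReal.ofReal (τ (n + N)) * ‖inner ℝ (v (n + N)) (w : H)‖ₑ
          ∂(stdGaussian Q')
        ≤ ∑' n, ENNReal.ofReal (τ (n + N) * ‖v (n + N)‖) := by
          refine ENNReal.tsum_le_tsum fun n => ?_
          rw [lintegral_const_mul' _ _ ENNReal.ofReal_ne_top, ENNReal.ofReal_mul (hτ0 i0 _)]
          gcongr
          refine lintegral_enorm_dual_stdGaussian_le
            ((innerSL ℝ (v (n + N))).comp Q'.subtypeL) ?_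
          refine (ContinuousLinearMap.opNorm_comp_le _ _).trans ?_
          rw [innerSL_apply_norm]
          exact mul_le_of_le_one_right (norm_nonneg _) (Submodule.norm_subtypeL_le _)
      _ = ENNReal.ofReal (∑' n, τ (n + N) * ‖v (n + N)‖) :=
          (ENNReal.ofReal_tsum_of_nonneg
            (fun n => mul_nonneg (hτ0 i0 _) (norm_nonneg _)) hsm).symm
      _ ≤ _ := ENNReal.ofReal_le_ofReal htail
  have hZhalf : ENNReal.ofReal (1 / 2) ≤ stdGaussian Q' {w | Z w < ENNReal.ofReal ε} := by
    have hZm' : Measurable Z := Measurable.tsum hZm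
    have hms : MeasurableSet {w | ENNReal.ofReal ε ≤ Z w} :=
      measurableSet_le measurable_const hZm'
    have h1 : stdGaussian Q' {w | ENNReal.ofReal ε ≤ Z w} ≤ ENNReal.ofReal (1 / 2) := by
      refine (meas_ge_le_lintegral_div hZm'.aemeasurable (by simpa using hε)
        ENNReal.ofReal_ne_top).trans ?_
      refine (ENNReal.div_le_div_right hZint _).trans ?_
      rw [← ENNReal.ofReal_div_of_pos hε]
      apply ENNReal.ofReal_le_ofReal
      apply le_of_eq
      field_simp
    have h2 : {w | Z w < ENNReal.ofReal ε} = {w | ENNReal.ofReal ε ≤ Z w}ᶜ := by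
      ext w; simp
    rw [h2, prob_compl_eq_one_sub hms]
    calc ENNReal.ofReal (1 / 2) = 1 - ENNReal.ofReal (1 / 2) := by
          rw [← ENNReal.ofReal_one, ← ENNReal.ofReal_sub _ (by norm_num)]
          norm_num
      _ ≤ _ := tsub_le_tsub_left h1 _
  have hyQ' : ∀ (w : Q') n, n < N → inner ℝ (v n) (w : H) = 0 := fun w n hn =>
    Submodule.inner_right_of_mem_orthogonal (hvQ n hn) (hQQ' w.2)
  have hyZ : ∀ (w : Q'), Z w < ENNReal.ofReal ε → ∀ i, |inner ℝ (y i) w| ≤ ε := by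
    intro w hw i
    have h1 : inner ℝ (y i) w = inner ℝ (φ i) (w : H) := by
      change inner ℝ (φ i - p (φ i)) (w : H) = _
      rw [inner_sub_left, Submodule.inner_right_of_mem_orthogonal
        (Q.starProjection_apply_mem (φ i)) (hQQ' w.2), sub_zero]
    have h2 : HasSum (fun n => t i n * inner ℝ (v n) (w : H)) (inner ℝ (φ i) (w : H)) := by
      have := (hφ i).mapL (innerSL ℝ (w : H))
      simp only [innerSL_apply_apply, real_inner_smul_right] at this
      simpa only [real_inner_comm (w : H)] using this
    have h3 := (hasSum_nat_add_iff' N).2 h2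
    rw [Finset.sum_eq_zero (fun n hn => by
      rw [hyQ' w n (Finset.mem_range.1 hn), mul_zero]), sub_zero] at h3
    have h4 : ‖inner ℝ (φ i) (w : H)‖ₑ ≤ Z w := by
      rw [← h3.tsum_eq]
      refine enorm_tsum_le_tsum_enorm.trans (ENNReal.tsum_le_tsum fun n => ?_)
      rw [enorm_mul]
      gcongr
      rw [← ofReal_norm]
      exact ENNReal.ofReal_le_ofReal (htτ i _)
    rw [h1, ← Real.norm_eq_abs]
    have h5 := h4.trans hw.le
    rw [← ofReal_norm, ENNReal.ofReal_le_ofReal_iff hε.le] at h5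
    exact h5
  have hdist : ∀ i, ‖φ i - p (φ i)‖ ≤ ε / 2 := by
    intro i
    have h1 := (hasSum_nat_add_iff' N).2 (hφ i)
    set q := ∑ n ∈ Finset.range N, t i n • v n with hq
    have hqQ : q ∈ Q := Submodule.sum_mem _ fun n hn =>
      Q.smul_mem _ (hvQ n (Finset.mem_range.1 hn))
    have h2 : φ i - p (φ i) = (φ i - q) - p (φ i - q) := by
      rw [map_sub, Q.starProjection_eq_self_iff.2 hqQ]
      abel
    have h3 : ‖φ i - p (φ i)‖ ≤ ‖φ i - q‖ := by
      have h4 := Submodule.norm_sq_eq_add_norm_sq_starProjection (φ i - q) Q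
      have h5 := Q.starProjection_orthogonal_val (φ i - q)
      rw [h5, ← h2] at h4
      refine (sq_le_sq₀ (norm_nonneg _) (norm_nonneg _)).1 ?_
      nlinarith [sq_nonneg ‖Q.starProjection (φ i - q)‖]
    refine h3.trans (le_trans ?_ htail)
    rw [← h1.tsum_eq]
    refine tsum_of_norm_bounded hsm.hasSum fun n => ?_
    rw [norm_smul]
    gcongr
    exact htτ i _
  have hsub : Metric.closedBall z (N * δ) ×ˢ {w | Z w < ENNReal.ofReal ε} ⊆
      {w : Q × Q' | ∀ i, (0 : ℝ) ≤ inner ℝ (x i) w.1 + inner ℝ (y i) w.2} := by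
    rintro ⟨w, w'⟩ ⟨hw, hw'⟩ i
    have h1 := abs_le.1 (hyZ w' hw' i)
    have h2 : inner ℝ (x i) w = inner ℝ (x i) z + inner ℝ (x i) (w - z) := by
      rw [← inner_add_right]; congr 1; abel
    have h3 : |inner ℝ (x i) (w - z)| ≤ ε := by
      refine (abs_real_inner_le_norm _ _).trans (le_trans ?_ hbδ)
      have hxb : ‖x i‖ ≤ b := (Q.norm_starProjection_apply_le _).trans (hb i)
      have hwz : ‖w - z‖ ≤ N * δ := by rw [← dist_eq_norm]; exact hw
      exact mul_le_mul hxb hwz (norm_nonneg _) ((norm_nonneg _).trans (hb i))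
    have h4 : inner ℝ (x i) z = inner ℝ (φ i) g - inner ℝ (φ i - p (φ i)) g := by
      change inner ℝ (p (φ i)) (p g) = _
      rw [← Q.inner_starProjection_left_eq_right, Q.starProjection_eq_self_iff.2
        (Q.starProjection_apply_mem (φ i)), inner_sub_left]
      exact (sub_sub_cancel _ _).symm
    have h5 : |inner ℝ (φ i - p (φ i)) g| ≤ ε / 2 := by
      refine (abs_real_inner_le_norm _ _).trans ?_
      have := hdist i
      nlinarith [norm_nonneg (φ i - p (φ i)), norm_nonneg g]
    have h6 := hφg i
    have h7 := abs_le.1 h3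
    have h8 := abs_le.1 h5
    change (0 : ℝ) ≤ inner ℝ (x i) w + inner ℝ (y i) w'
    linarith [h1.1, h7.1, h8.2]
  refine le_trans ?_ (measure_mono hsub)
  rw [Measure.prod_prod]
  calc ENNReal.ofReal ((δ / 20) ^ N / 2)
      = ENNReal.ofReal ((δ / 20) ^ N) * ENNReal.ofReal (1 / 2) := by
        rw [← ENNReal.ofReal_mul (by positivity)]
        congr 1
        ring
    _ ≤ _ := mul_le_mul' (stdGaussian_closedBall_ge hz hrank hδ0 hδ) hZhalf

lemma exists_spaced_nodes {δ : ℝ} (hδ : 0 ≤ δ) (N : ℕ) : ∀ {E : Set ℝ}, BddBelow E → BddAbove E →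
    ENNReal.ofReal (N * δ) < volume E →
    ∃ x : ℕ → ℝ, (∀ i < N, x i ∈ E) ∧ ∀ i, i + 1 < N → x i + δ ≤ x (i + 1) := by
  induction N with
  | zero => exact fun _ _ _ => ⟨fun _ => 0, by simp, by simp⟩
  | succ N ih =>
    intro E hb ha hE
    have hne : E.Nonempty := by
      rw [Set.nonempty_iff_ne_empty]
      intro h
      rw [h, measure_empty] at hE
      exact not_lt_zero hE
    have hfin : volume E ≠ ⊤ := by
      obtain ⟨l, hl⟩ := hb
      obtain ⟨u, hu⟩ := ha
      refine ((measure_mono (fun y hy => ⟨hl hy, hu hy⟩ : E ⊆ Set.Icc l u)).trans_lt ?_).ne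
      exact measure_Icc_lt_top
    obtain ⟨x₀, hx₀, hlt⟩ := exists_lt_of_csInf_lt hne
      (show sInf E < sInf E + ((volume E).toReal - (N + 1 : ℕ) * δ) by
        have := (ENNReal.ofReal_lt_iff_lt_toReal (by positivity) hfin).1 hE
        linarith)
    have hsplit : E ⊆ Set.Ico (sInf E) (x₀ + δ) ∪ E ∩ Set.Ici (x₀ + δ) := by
      intro y hy
      rcases lt_or_ge y (x₀ + δ) with h | h
      · exact Or.inl ⟨csInf_le hb hy, h⟩
      · exact Or.inr ⟨hy, h⟩
    have hvol : volume E ≤ ENNReal.ofReal (x₀ + δ - sInf E) + volume (E ∩ Set.Ici (x₀ + δ)) := by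
      refine (measure_mono hsplit).trans ((measure_union_le _ _).trans ?_)
      rw [Real.volume_Ico]
    have hbig : ENNReal.ofReal (N * δ) < volume (E ∩ Set.Ici (x₀ + δ)) := by
      by_contra! hcon
      have h0 : 0 ≤ x₀ - sInf E := sub_nonneg.2 (csInf_le hb hx₀)
      have h1 := hvol.trans (add_le_add_right hcon _)
      rw [← ENNReal.ofReal_add (by linarith) (by positivity)] at h1
      have h2 := ENNReal.toReal_le_of_le_ofReal (add_nonneg (by linarith) (by positivity)) h1
      push_cast at hlt
      linarith
    obtain ⟨y, hy, hyδ⟩ := ih (hb.mono Set.inter_subset_left) (ha.mono Set.inter_subset_left) hbig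
    refine ⟨fun i => Nat.casesOn i x₀ y, ?_, ?_⟩
    · rintro (_ | i) hi
      · exact hx₀
      · exact (hy i (by omega)).1
    · rintro (_ | i) hi
      · exact (hy 0 (by omega)).2
      · exact hyδ i (by omega)

lemma prod_erase_abs_sub {i n : ℕ} (hi : i ≤ n) :
    ∏ j ∈ (Finset.range (n + 1)).erase i, |(i : ℝ) - j| = i.factorial * (n - i).factorial := by
  induction n, hi using Nat.le_induction with
  | base =>
    have : (Finset.range (i + 1)).erase i = Finset.range i := by
      ext j; simp; omega
    rw [this, ← Finset.prod_range_reflect, Nat.sub_self, Nat.factorial_zero, Nat.cast_one, mul_one,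
      ← Finset.prod_range_add_one_eq_factorial, Nat.cast_prod]
    refine Finset.prod_congr rfl fun j hj => ?_
    have hj := Finset.mem_range.1 hj
    have : ((i - 1 - j : ℕ) : ℝ) = i - (j + 1) := by
      rw [Nat.sub_sub, Nat.cast_sub (by omega)]; push_cast; ring
    rw [this]
    have h2 : (i : ℝ) - (i - (j + 1)) = ((j + 1 : ℕ) : ℝ) := by push_cast; ring
    rw [h2, Nat.abs_cast]
  | succ n hn ih =>
    have : (Finset.range (n + 1 + 1)).erase i = insert (n + 1) ((Finset.range (n + 1)).erase i) := by
      ext j; simp; omega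
    rw [this, Finset.prod_insert (by simp), ih, Nat.succ_sub hn, Nat.factorial_succ]
    have h2 : (i : ℝ) - (n + 1 : ℕ) = -((n - i + 1 : ℕ) : ℝ) := by
      push_cast [Nat.cast_sub hn]; ring
    rw [h2, abs_neg, Nat.abs_cast]
    push_cast
    ring

/-- A Remez-type inequality: a polynomial that is small on a set of positive measure cannot be
large at the origin. -/
lemma norm_eval_zero_le_of_le_on {R m s : ℝ} (hm : 0 < m) {E : Set ℝ}
    (hER : E ⊆ Set.Icc (-R) R) (hEm : ENNReal.ofReal m < volume E) {N : ℕ}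
    {p : Polynomial ℂ} (hp : p.degree < N) (hs : ∀ y ∈ E, ‖p.eval (y : ℂ)‖ ≤ s) :
    ‖p.eval 0‖ ≤ (2 * R * Real.exp 1 / m) ^ N * s := by
  rcases N with _ | n
  · have : p = 0 := by
      rw [← Polynomial.degree_eq_bot]
      simpa using hp
    have hne : E.Nonempty := by
      rw [Set.nonempty_iff_ne_empty]
      rintro rfl
      simp at hEm
    obtain ⟨y, hy⟩ := hne
    simpa [this] using hs y hy
  set δ := m / (n + 1 : ℕ) with hδ
  have hδ0 : 0 < δ := by positivity
  obtain ⟨x, hxE, hxδ⟩ := exists_spaced_nodes hδ0.le (n + 1)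
    (bddBelow_Icc.mono hER) (bddAbove_Icc.mono hER) (by
      rwa [hδ, mul_div_cancel₀]
      positivity)
  have hs0 : 0 ≤ s := (norm_nonneg _).trans (hs _ (hxE 0 (by omega)))
  have hgap : ∀ i k, i + k < n + 1 → x i + k * δ ≤ x (i + k) := by
    intro i k
    induction k with
    | zero => simp
    | succ k ih =>
      intro hk
      have h1 := ih (by omega)
      have h2 := hxδ (i + k) (by omega)
      push_cast
      rw [← add_assoc]
      linarith
  have hgap' : ∀ i < n + 1, ∀ j < n + 1, |(i : ℝ) - j| * δ ≤ |x i - x j| := by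
    intro i hi j hj
    rcases le_total i j with h | h
    · obtain ⟨k, rfl⟩ := Nat.exists_eq_add_of_le h
      have := hgap i k hj
      have h1 : (i : ℝ) - (i + k : ℕ) = -(k : ℝ) := by push_cast; ring
      rw [h1, abs_neg, Nat.abs_cast, abs_sub_comm]
      exact le_trans (by linarith) (le_abs_self _)
    · obtain ⟨k, rfl⟩ := Nat.exists_eq_add_of_le h
      have := hgap j k hi
      have h1 : ((j + k : ℕ) : ℝ) - j = (k : ℝ) := by push_cast; ring
      rw [h1, Nat.abs_cast]
      exact le_trans (by linarith) (le_abs_self _)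
  have hR : 0 ≤ R := by
    have := hER (hxE 0 (by omega))
    linarith [this.1, this.2]
  have hmR : m ≤ 2 * R := by
    have h1 := hEm.trans_le (measure_mono hER)
    rw [Real.volume_Icc, ENNReal.ofReal_lt_ofReal_iff'] at h1
    linarith [h1.1]
  have hinj : Set.InjOn (fun i => (x i : ℂ)) (Finset.range (n + 1)) := by
    intro i hi j hj hij
    have h1 := hgap' i (by simpa using hi) j (by simpa using hj)
    have h2 : x i = x j := by simpa using hij
    rw [h2, sub_self, abs_zero] at h1
    have h3 : |(i : ℝ) - j| ≤ 0 := by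
      by_contra! h
      have := mul_pos h hδ0
      linarith
    have h4 := abs_nonpos_iff.1 h3
    exact_mod_cast sub_eq_zero.1 h4
  have hbasis : ∀ i ∈ Finset.range (n + 1),
      ‖(Lagrange.basis (Finset.range (n + 1)) (fun i => (x i : ℂ)) i).eval 0‖
        ≤ (R / δ) ^ n / n.factorial * (n.choose i) := by
    intro i hi
    have hin := Finset.mem_range.1 hi
    rw [Lagrange.basis, Polynomial.eval_prod, norm_prod]
    calc ∏ j ∈ (Finset.range (n + 1)).erase i,
          ‖(Lagrange.basisDivisor (x i : ℂ) (x j : ℂ)).eval 0‖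
        ≤ ∏ j ∈ (Finset.range (n + 1)).erase i, (R / δ) * |(i : ℝ) - j|⁻¹ := by
          refine Finset.prod_le_prod (fun _ _ => norm_nonneg _) fun j hj => ?_
          have hj' := Finset.mem_erase.1 hj
          have hjn := Finset.mem_range.1 hj'.2
          have hpos : 0 < |(i : ℝ) - j| := by
            rw [abs_pos, sub_ne_zero]
            exact_mod_cast hj'.1.symm
          have hxj : |x j| ≤ R := abs_le.2 (hER (hxE j hjn))
          have heq : ‖(Lagrange.basisDivisor (x i : ℂ) (x j : ℂ)).eval 0‖
              = |x j| / |x i - x j| := by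
            simp only [Lagrange.basisDivisor, Polynomial.eval_mul, Polynomial.eval_C,
              Polynomial.eval_sub, Polynomial.eval_X, zero_sub, norm_mul, norm_neg, norm_inv,
              ← Complex.ofReal_sub, Complex.norm_real, Real.norm_eq_abs]
            rw [div_eq_inv_mul]
          rw [heq]
          calc |x j| / |x i - x j| ≤ R / (|(i : ℝ) - j| * δ) :=
                div_le_div₀ hR hxj (by positivity) (hgap' i hin j hjn)
            _ = _ := by field_simp
      _ = (R / δ) ^ n * ((i.factorial : ℝ) * (n - i).factorial)⁻¹ := by
          rw [Finset.prod_mul_distrib, Finset.prod_const, Finset.card_erase_of_mem hi,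
            Finset.card_range, Nat.add_sub_cancel, Finset.prod_inv_distrib,
            prod_erase_abs_sub (by omega)]
      _ = _ := by
          rw [Nat.cast_choose ℝ (by omega : i ≤ n)]
          field_simp
  rw [Lagrange.eq_interpolate (f := p) hinj (by simpa using hp), Lagrange.interpolate_apply,
    Polynomial.eval_finsetSum]
  calc ‖∑ i ∈ Finset.range (n + 1), (Polynomial.C (p.eval (x i : ℂ)) *
        Lagrange.basis (Finset.range (n + 1)) (fun i => (x i : ℂ)) i).eval 0‖
      ≤ ∑ i ∈ Finset.range (n + 1), s * ((R / δ) ^ n / n.factorial * (n.choose i)) := by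
        refine norm_sum_le_of_le _ fun i hi => ?_
        rw [Polynomial.eval_mul, Polynomial.eval_C, norm_mul]
        exact mul_le_mul (hs _ (hxE i (Finset.mem_range.1 hi))) (hbasis i hi) (norm_nonneg _) hs0
    _ = s * ((2 * R / m) ^ n * ((n + 1 : ℕ) ^ n / n.factorial)) := by
        rw [← Finset.mul_sum, ← Finset.mul_sum]
        have := Nat.sum_range_choose n
        rw [← Nat.cast_sum, this, hδ]
        push_cast
        rw [div_div_eq_mul_div, mul_div_assoc, div_pow, mul_pow, div_pow, mul_pow]
        field_simp
    _ ≤ s * ((2 * R / m) ^ (n + 1) * Real.exp (n + 1 : ℕ)) := by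
        have h1 : 1 ≤ 2 * R / m := (one_le_div hm).2 hmR
        have h2 := Real.pow_div_factorial_le_exp ((n + 1 : ℕ) : ℝ) (by positivity) n
        gcongr
        omega
    _ = _ := by
        rw [← Real.exp_one_pow, ← mul_pow, mul_comm s]
        congr 2
        ring

lemma exists_inner_ge_of_convexHull {H : Type*} [NormedAddCommGroup H] [InnerProductSpace ℝ H]
    {ι : Type*} [Finite ι] (φ : ι → H) {η : ℝ} (hη : 0 < η)
    (h : ∀ w ∈ convexHull ℝ (Set.range φ), η ≤ ‖w‖) :
    ∃ g : H, ‖g‖ ≤ 1 ∧ ∀ i, η ≤ inner ℝ (φ i) g := by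
  rcases isEmpty_or_nonempty ι with hι | hι
  · exact ⟨0, by simp, fun i => hι.elim i⟩
  set K := convexHull ℝ (Set.range φ)
  have hφK : ∀ i, φ i ∈ K := fun i => subset_convexHull ℝ _ ⟨i, rfl⟩
  obtain ⟨v, hvK, hv⟩ := exists_norm_eq_iInf_of_complete_convex (K := K)
    ⟨_, hφK (Classical.arbitrary ι)⟩ ((Set.finite_range φ).isCompact_convexHull ℝ).isComplete
    (convex_convexHull ℝ _) 0
  rw [norm_eq_iInf_iff_real_inner_le_zero (convex_convexHull ℝ _) hvK] at hv
  have hv0 : 0 < ‖v‖ := hη.trans_le (h v hvK)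
  refine ⟨‖v‖⁻¹ • v, ?_, fun i => ?_⟩
  · rw [norm_smul, norm_inv, norm_norm, inv_mul_cancel₀ hv0.ne']
  · have h1 := hv _ (hφK i)
    rw [zero_sub, inner_neg_left, inner_sub_right, real_inner_self_eq_norm_sq] at h1
    rw [real_inner_smul_right, real_inner_comm]
    refine (h v hvK).trans ?_
    rw [inv_mul_eq_div, le_div_iff₀ hv0]
    linarith

/-- A nontrivial absolutely continuous part dominates a multiple of Lebesgue measure on a set of
positive measure. -/
lemma exists_measurableSet_le_of_rnDeriv_ne_zero {μ : Measure ℝ} {K : Set ℝ}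
    (hKm : MeasurableSet K) (hK : μ Kᶜ = 0) (hac : volume.withDensity (μ.rnDeriv volume) ≠ 0) :
    ∃ (c : ℝ) (E : Set ℝ), 0 < c ∧ MeasurableSet E ∧ E ⊆ K ∧ volume E ≠ 0 ∧
      ∀ A ⊆ E, MeasurableSet A → ENNReal.ofReal c * volume A ≤ μ A := by
  have hm := Measure.measurable_rnDeriv μ volume
  have hle : ∀ A, MeasurableSet A → ∫⁻ y in A, μ.rnDeriv volume y ≤ μ A := by
    intro A hA
    rw [← withDensity_apply _ hA]
    exact Measure.withDensity_rnDeriv_le μ volume A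
  by_contra! hcon
  apply hac
  rw [withDensity_eq_zero_iff hm.aemeasurable]
  have h1 : ∀ n : ℕ, volume ({y | ENNReal.ofReal (1 / (n + 1)) ≤ μ.rnDeriv volume y} ∩ K) = 0 := by
    intro n
    by_contra h
    obtain ⟨A, hAE, hAm, hA⟩ := hcon (1 / (n + 1)) _ (by positivity)
      ((measurableSet_le measurable_const hm).inter hKm) Set.inter_subset_right h
    refine absurd hA (not_lt.2 ?_)
    refine le_trans ?_ (hle A hAm)
    rw [← setLIntegral_const]
    exact setLIntegral_mono' hAm fun y hy => (hAE hy).1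
  have h2 : ∀ᵐ y, y ∈ Kᶜ → μ.rnDeriv volume y = 0 := by
    have := hle _ hKm.compl
    rw [hK, nonpos_iff_eq_zero, lintegral_eq_zero_iff hm] at this
    exact (ae_restrict_iff' hKm.compl).1 this
  have h3 : ∀ᵐ y, ∀ n : ℕ,
      ¬ (y ∈ {y | ENNReal.ofReal (1 / (n + 1)) ≤ μ.rnDeriv volume y} ∩ K) := by
    rw [ae_all_iff]
    intro n
    exact measure_eq_zero_iff_ae_notMem.1 (h1 n)
  filter_upwards [h2, h3] with y hy2 hy3
  by_cases hyK : y ∈ K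
  · by_contra h0
    have hpos : 0 < μ.rnDeriv volume y := pos_iff_ne_zero.2 h0
    obtain ⟨r, hr0, hr⟩ := ENNReal.lt_iff_exists_nnreal_btwn.1 hpos
    obtain ⟨n, hn⟩ := exists_nat_one_div_lt (show (0 : ℝ) < r by exact_mod_cast hr0)
    refine hy3 n ⟨?_, hyK⟩
    refine le_trans ?_ hr.le
    rw [← ENNReal.ofReal_coe_nnreal]
    exact ENNReal.ofReal_le_ofReal hn.le
  · exact hy2 hyK

lemma norm_Lp_ge_of_polynomial {μ : Measure ℝ} [IsFiniteMeasure μ] {R c : ℝ} (hc : 0 < c)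
    {E : Set ℝ} (hEm : MeasurableSet E) (hER : E ⊆ Set.Icc (-R) R) (hE0 : volume E ≠ 0)
    (hE : ∀ A ⊆ E, MeasurableSet A → ENNReal.ofReal c * volume A ≤ μ A) {m : ℝ}
    (hm : m = (volume E).toReal / 2) {D : ℝ} (hD : D = 2 * R * Real.exp 1 / m) (hD0 : 0 < D)
    {N : ℕ} {p : Polynomial ℂ} (hp : p.degree < N) (hp0 : p.eval 0 = 1) {θ : ℝ}
    (hθ : θ ≤ (D ^ N)⁻¹ / 4) {h : Lp ℂ 2 μ} (hh : ∀ᵐ y ∂μ, ‖h y - p.eval (y : ℂ)‖ ≤ θ) :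
    √(c * m) * ((D ^ N)⁻¹ / 4) ≤ ‖h‖ := by
  have hfin : volume E ≠ ⊤ := ((measure_mono hER).trans_lt measure_Icc_lt_top).ne
  have hEpos : 0 < (volume E).toReal := ENNReal.toReal_pos hE0 hfin
  have hm0 : 0 < m := by rw [hm]; positivity
  set s := (D ^ N)⁻¹ / 4 with hs
  have hs0 : 0 < s := by positivity
  set A := E ∩ {y : ℝ | 2 * s ≤ ‖p.eval (y : ℂ)‖} with hA
  have hpc : Continuous fun y : ℝ => ‖p.eval (y : ℂ)‖ := by fun_prop
  have hAm : MeasurableSet A := hEm.inter (measurableSet_le measurable_const hpc.measurable)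
  have h1 : volume (E \ A) ≤ ENNReal.ofReal m := by
    by_contra! hcon
    have := norm_eval_zero_le_of_le_on (s := 2 * s) hm0 (Set.sdiff_subset.trans hER) hcon hp (by
      intro y hy
      by_contra! hlt
      exact hy.2 ⟨hy.1, hlt.le⟩)
    rw [hp0, norm_one, ← hD, hs] at this
    have h2 : D ^ N * (2 * ((D ^ N)⁻¹ / 4)) = 1 / 2 := by field_simp; norm_num
    linarith
  have h2 : ENNReal.ofReal m ≤ volume A := by
    have h3 : volume E ≤ volume A + volume (E \ A) := by
      refine (measure_mono ?_).trans (measure_union_le _ _)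
      intro y hy
      by_cases hyA : y ∈ A
      · exact Or.inl hyA
      · exact Or.inr ⟨hy, hyA⟩
    have h4 : volume E = ENNReal.ofReal m + ENNReal.ofReal m := by
      rw [← ENNReal.ofReal_add hm0.le hm0.le, hm, add_halves, ENNReal.ofReal_toReal hfin]
    rw [h4] at h3
    exact (ENNReal.add_le_add_iff_right ENNReal.ofReal_ne_top).1
      (h3.trans (add_le_add_right h1 _))
  have h3 : ENNReal.ofReal (c * m) ≤ μ A := by
    rw [ENNReal.ofReal_mul hc.le]
    exact (mul_le_mul_right h2 _).trans (hE A Set.inter_subset_left hAm)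
  have h4 : c * m ≤ μ.real {y | s ^ 2 ≤ ‖h y‖ ^ 2} := by
    rw [measureReal_def, ← ENNReal.ofReal_le_iff_le_toReal (measure_ne_top _ _)]
    refine h3.trans (measure_mono_ae ?_)
    filter_upwards [hh] with y hy hyA
    have h5 : 2 * s ≤ ‖p.eval (y : ℂ)‖ := hyA.2
    have h6 := norm_sub_norm_le (p.eval (y : ℂ)) (p.eval (y : ℂ) - h y)
    rw [sub_sub_cancel, norm_sub_rev] at h6
    exact pow_le_pow_left₀ hs0.le (by linarith) 2
  have h_int : Integrable (fun y => ‖h y‖ ^ 2) μ := (Lp.memLp h).integrable_norm_pow two_ne_zero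
  have h5 := mul_meas_ge_le_integral_of_nonneg (μ := μ) (f := fun y => ‖h y‖ ^ 2)
    (Filter.Eventually.of_forall fun y => by positivity) h_int (s ^ 2)
  have h6 : ‖h‖ ^ 2 = ∫ y, ‖h y‖ ^ 2 ∂μ := by
    rw [← real_inner_self_eq_norm_sq, L2.inner_def]
    simp
  rw [← h6] at h5
  have h7 : (√(c * m) * s) ^ 2 ≤ ‖h‖ ^ 2 := by
    rw [mul_pow, Real.sq_sqrt (by positivity)]
    nlinarith [sq_nonneg s]
  exact (sq_le_sq₀ (by positivity) (norm_nonneg _)).1 h7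

lemma hasSum_exp_tail (u : ℝ) (N : ℕ) :
    HasSum (fun n : ℕ => u ^ (n + N) / (n + N).factorial)
      (Real.exp u - ∑ n ∈ Finset.range N, u ^ n / n.factorial) := by
  refine (hasSum_nat_add_iff' (f := fun n : ℕ => u ^ n / n.factorial) N).2 ?_
  rw [Real.exp_eq_exp_ℝ]
  exact NormedSpace.expSeries_div_hasSum_exp u

lemma exp_tail_le {u κ : ℝ} (hu : 0 ≤ u) (hκ0 : 0 < κ) (hκ : κ ≤ 1) (N : ℕ) :
    Real.exp u - ∑ n ∈ Finset.range N, u ^ n / n.factorial ≤ κ ^ N * Real.exp (u / κ) := by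
  refine (hasSum_le ?_ (hasSum_exp_tail u N)
    ((hasSum_exp_tail (u / κ) N).mul_left (κ ^ N))).trans ?_
  · intro n
    have h1 : u ^ (n + N) = κ ^ n * κ ^ N * (u / κ) ^ (n + N) := by
      rw [← pow_add, ← mul_pow, mul_div_cancel₀ _ hκ0.ne']
    rw [h1, mul_div_assoc, mul_assoc]
    exact mul_le_of_le_one_left (by positivity) (pow_le_one₀ hκ0.le hκ)
  · gcongr
    have : 0 ≤ ∑ n ∈ Finset.range N, (u / κ) ^ n / n.factorial :=
      Finset.sum_nonneg fun n _ => by positivity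
    linarith

/-- The exponentials `y ↦ exp (2πixy)` and the monomials `y ↦ (iy)ⁿ` as vectors in `L²(μ)`. -/
lemma exists_exponential_features {μ : Measure ℝ} [IsFiniteMeasure μ] {R : ℝ} (hR : 0 < R)
    (hμ : μ (Set.Icc (-R) R)ᶜ = 0) :
    ∃ (b : ℝ) (v : ℕ → Lp ℂ 2 μ) (φ : ℝ → Lp ℂ 2 μ), 1 ≤ b ∧ (∀ n, ‖v n‖ ≤ b * R ^ n) ∧
      (∀ x, ‖φ x‖ ≤ b) ∧
      (∀ x, ∀ᵐ y ∂μ, φ x y = Complex.exp ((2 * π * x : ℝ) * (Complex.I * y))) ∧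
      (∀ s t, inner ℝ (φ s) (φ t) = ∫ y, Real.cos (2 * π * (s - t) * y) ∂μ) ∧
      ∀ x, HasSum (fun n : ℕ => ((2 * π * x) ^ n / n.factorial) • v n) (φ x) := by
  have hae : ∀ᵐ y ∂μ, |y| ≤ R := by
    filter_upwards [measure_eq_zero_iff_ae_notMem.1 hμ] with y hy
    exact abs_le.2 (not_not.1 hy)
  set b : ℝ := max 1 (measureUnivNNReal μ ^ (2 : ENNReal).toReal⁻¹) with hb
  have hb1 : 1 ≤ b := le_max_left _ _
  have hnorm : ∀ (g : Lp ℂ 2 μ) (C : ℝ), 0 ≤ C → (∀ᵐ y ∂μ, ‖g y‖ ≤ C) → ‖g‖ ≤ b * C := by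
    intro g C hC hg
    exact (Lp.norm_le_of_ae_bound hC hg).trans
      (mul_le_mul_of_nonneg_right (le_max_right _ _) hC)
  have hvm : ∀ n : ℕ, MemLp (fun y : ℝ => (Complex.I * (y : ℂ)) ^ n) 2 μ := by
    intro n
    refine MemLp.of_bound (by fun_prop) (R ^ n) ?_
    filter_upwards [hae] with y hy
    rw [norm_pow, norm_mul, Complex.norm_I, one_mul, Complex.norm_real]
    exact pow_le_pow_left₀ (norm_nonneg _) hy n
  have hE : ∀ x y : ℝ, ‖Complex.exp ((2 * π * x : ℝ) * (Complex.I * y))‖ = 1 := by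
    intro x y
    rw [Complex.norm_exp]
    simp
  have hφm : ∀ x : ℝ, MemLp (fun y : ℝ => Complex.exp ((2 * π * x : ℝ) * (Complex.I * y))) 2 μ := by
    intro x
    refine MemLp.of_bound (by fun_prop) 1 (Filter.Eventually.of_forall fun y => (hE x y).le)
  set v : ℕ → Lp ℂ 2 μ := fun n => (hvm n).toLp with hv
  set φ : ℝ → Lp ℂ 2 μ := fun x => (hφm x).toLp with hφ
  have hvc : ∀ n, ∀ᵐ y ∂μ, v n y = (Complex.I * (y : ℂ)) ^ n := fun n => (hvm n).coeFn_toLp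
  have hφc : ∀ x, ∀ᵐ y ∂μ, φ x y = Complex.exp ((2 * π * x : ℝ) * (Complex.I * y)) :=
    fun x => (hφm x).coeFn_toLp
  have hvn : ∀ n, ‖v n‖ ≤ b * R ^ n := by
    intro n
    refine hnorm _ _ (by positivity) ?_
    filter_upwards [hvc n, hae] with y hy hyR
    rw [hy, norm_pow, norm_mul, Complex.norm_I, one_mul, Complex.norm_real]
    exact pow_le_pow_left₀ (norm_nonneg _) hyR n
  refine ⟨b, v, φ, hb1, hvn, ?_, hφc, ?_, ?_⟩
  · intro x
    refine (hnorm _ 1 zero_le_one ?_).trans_eq (mul_one b)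
    filter_upwards [hφc x] with y hy
    rw [hy, hE]
  · intro s t
    rw [L2.inner_def]
    refine integral_congr_ae ?_
    filter_upwards [hφc s, hφc t] with y hs ht
    rw [hs, ht, Complex.inner, ← Complex.exp_conj, ← Complex.exp_add]
    rw [show (2 * π * t : ℝ) * (Complex.I * y) +
      (starRingEnd ℂ) ((2 * π * s : ℝ) * (Complex.I * y)) = ((-(2 * π * (s - t) * y) : ℝ) : ℂ) * Complex.I by
        simp only [map_mul, Complex.conj_ofReal, Complex.conj_I]
        push_cast
        ring,
      Complex.exp_ofReal_mul_I_re, Real.cos_neg]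
  · intro x
    set u := |2 * π * x| * R with hu
    have hterm : ∀ n : ℕ, ‖((2 * π * x) ^ n / n.factorial) • v n‖ ≤ b * (u ^ n / n.factorial) := by
      intro n
      rw [norm_smul, norm_div, norm_pow, Real.norm_eq_abs, Real.norm_natCast, hu, mul_pow]
      calc |2 * π * x| ^ n / n.factorial * ‖v n‖
          ≤ |2 * π * x| ^ n / n.factorial * (b * R ^ n) := by gcongr; exact hvn n
        _ = _ := by ring
    have hsum : Summable fun n : ℕ => ‖((2 * π * x) ^ n / n.factorial) • v n‖ :=
      Summable.of_nonneg_of_le (fun n => norm_nonneg _) hterm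
        ((Real.summable_pow_div_factorial u).mul_left b)
    rw [hasSum_iff_tendsto_nat_of_summable_norm hsum, tendsto_iff_norm_sub_tendsto_zero]
    have htail : Filter.Tendsto
        (fun N => b * (Real.exp u - ∑ n ∈ Finset.range N, u ^ n / n.factorial))
        Filter.atTop (nhds 0) := by
      have h1 : HasSum (fun n : ℕ => u ^ n / n.factorial) (Real.exp u) := by
        rw [Real.exp_eq_exp_ℝ]
        exact NormedSpace.expSeries_div_hasSum_exp u
      have := (h1.tendsto_sum_nat.const_sub (Real.exp u)).const_mul b
      rwa [sub_self, mul_zero] at this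
    refine squeeze_zero (fun _ => norm_nonneg _) (fun N => ?_) htail
    rw [norm_sub_rev]
    have hall : ∀ᵐ y ∂μ, ∀ n : ℕ, (((2 * π * x) ^ n / n.factorial) • v n : Lp ℂ 2 μ) y =
        (((2 * π * x : ℝ) : ℂ) * (Complex.I * y)) ^ n / n.factorial := by
      rw [ae_all_iff]
      intro n
      filter_upwards [Lp.coeFn_smul ((2 * π * x) ^ n / n.factorial) (v n), hvc n] with y h1 h2
      rw [h1, Pi.smul_apply, h2, Complex.real_smul]
      push_cast
      ring
    have hpt : ∀ᵐ y ∂μ, ‖(φ x - ∑ n ∈ Finset.range N, ((2 * π * x) ^ n / n.factorial) • v n :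
        Lp ℂ 2 μ) y‖ ≤ Real.exp u - ∑ n ∈ Finset.range N, u ^ n / n.factorial := by
      filter_upwards [hall, hφc x, hae, Lp.coeFn_sub (φ x)
        (∑ n ∈ Finset.range N, ((2 * π * x) ^ n / n.factorial) • v n),
        Lp.coeFn_fun_finsetSum (Finset.range N) fun n => ((2 * π * x) ^ n / n.factorial) • v n]
        with y h1 h2 h3 h4 h5
      rw [h4, Pi.sub_apply, h5, h2, Finset.sum_congr rfl fun n _ => h1 n]
      refine (Complex.norm_exp_sub_sum_le_exp_norm_sub_sum _ N).trans ?_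
      refine hasSum_le (fun n => ?_) (hasSum_exp_tail _ N) (hasSum_exp_tail _ N)
      rw [norm_mul, norm_mul, Complex.norm_I, one_mul, Complex.norm_real, Complex.norm_real]
      gcongr
      rw [hu]
      exact mul_le_mul_of_nonneg_left h3 (abs_nonneg _)
    refine hnorm _ _ ?_ hpt
    exact (hasSum_exp_tail u N).nonneg fun n => by positivity

lemma exists_polynomial_of_mem_convexHull {μ : Measure ℝ} {R L θ : ℝ} {N : ℕ} (hN : N ≠ 0)
    (hμ : μ (Set.Icc (-R) R)ᶜ = 0) (hL : 0 ≤ L)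
    (hθ : Real.exp (2 * π * L * R) - ∑ n ∈ Finset.range N, (2 * π * L * R) ^ n / n.factorial ≤ θ)
    {φ : ℝ → Lp ℂ 2 μ}
    (hφ : ∀ x, ∀ᵐ y ∂μ, φ x y = Complex.exp ((2 * π * x : ℝ) * (Complex.I * y)))
    {ι : Type*} {x : ι → ℝ} (hx : ∀ i, x i ∈ Set.Icc 0 L) {h : Lp ℂ 2 μ}
    (hh : h ∈ convexHull ℝ (Set.range fun i => φ (x i))) :
    ∃ p : Polynomial ℂ, p.degree < N ∧ p.eval 0 = 1 ∧ ∀ᵐ y ∂μ, ‖h y - p.eval (y : ℂ)‖ ≤ θ := by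
  have hae : ∀ᵐ y ∂μ, |y| ≤ R := by
    filter_upwards [measure_eq_zero_iff_ae_notMem.1 hμ] with y hy
    exact abs_le.2 (not_not.1 hy)
  have hconv : Convex ℝ {h : Lp ℂ 2 μ | ∃ p : Polynomial ℂ, p.degree < N ∧ p.eval 0 = 1 ∧
      ∀ᵐ y ∂μ, ‖h y - p.eval (y : ℂ)‖ ≤ θ} := by
    rintro h₁ ⟨p, hp, hp0, hhp⟩ h₂ ⟨q, hq, hq0, hhq⟩ α β hα hβ hαβ
    have hαβ' : (α : ℂ) + β = 1 := by exact_mod_cast hαβ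
    refine ⟨Polynomial.C (α : ℂ) * p + Polynomial.C (β : ℂ) * q, ?_, ?_, ?_⟩
    · refine (Polynomial.degree_add_le _ _).trans_lt (max_lt ?_ ?_)
      · rw [← Polynomial.smul_eq_C_mul]; exact (Polynomial.degree_smul_le _ _).trans_lt hp
      · rw [← Polynomial.smul_eq_C_mul]; exact (Polynomial.degree_smul_le _ _).trans_lt hq
    · simp [hp0, hq0, hαβ']
    · filter_upwards [hhp, hhq, Lp.coeFn_add (α • h₁) (β • h₂), Lp.coeFn_smul α h₁,
        Lp.coeFn_smul β h₂] with y h3 h4 h5 h6 h7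
      rw [h5, Pi.add_apply, h6, h7, Pi.smul_apply, Pi.smul_apply, Complex.real_smul,
        Complex.real_smul]
      simp only [Polynomial.eval_add, Polynomial.eval_mul, Polynomial.eval_C]
      rw [show (α : ℂ) * h₁ y + β * h₂ y - (α * p.eval (y : ℂ) + β * q.eval (y : ℂ)) =
        α * (h₁ y - p.eval (y : ℂ)) + β * (h₂ y - q.eval (y : ℂ)) by ring]
      refine (norm_add_le _ _).trans ?_
      rw [norm_mul, norm_mul, Complex.norm_of_nonneg hα, Complex.norm_of_nonneg hβ]
      calc _ ≤ α * θ + β * θ := by gcongr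
        _ = θ := by rw [← add_mul, hαβ, one_mul]
  refine convexHull_min ?_ hconv hh
  rintro _ ⟨i, rfl⟩
  set z : ℂ := (2 * π * x i : ℝ) * Complex.I with hz
  refine ⟨∑ n ∈ Finset.range N, Polynomial.C (z ^ n / n.factorial) * Polynomial.X ^ n, ?_, ?_, ?_⟩
  · rw [Polynomial.degree_lt_iff_coeff_zero]
    intro j hj
    simp only [Polynomial.finsetSum_coeff, Polynomial.coeff_C_mul_X_pow]
    refine Finset.sum_eq_zero fun n hn => if_neg ?_
    have := Finset.mem_range.1 hn
    omega
  · obtain ⟨M, rfl⟩ := Nat.exists_eq_succ_of_ne_zero hN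
    simp [Polynomial.eval_finsetSum, Finset.sum_range_succ']
  · filter_upwards [hφ (x i), hae] with y h1 h2
    have h3 : (∑ n ∈ Finset.range N, Polynomial.C (z ^ n / n.factorial) * Polynomial.X ^ n).eval
        (y : ℂ) = ∑ n ∈ Finset.range N, ((2 * π * x i : ℝ) * (Complex.I * y)) ^ n / n.factorial := by
      rw [Polynomial.eval_finsetSum]
      refine Finset.sum_congr rfl fun n _ => ?_
      simp only [Polynomial.eval_mul, Polynomial.eval_C, Polynomial.eval_pow, Polynomial.eval_X, hz]
      ring
    rw [h1, h3]
    refine (Complex.norm_exp_sub_sum_le_exp_norm_sub_sum _ N).trans (le_trans ?_ hθ)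
    refine hasSum_le (fun n => ?_) (hasSum_exp_tail _ N) (hasSum_exp_tail _ N)
    rw [norm_mul, norm_mul, Complex.norm_I, one_mul, Complex.norm_real, Complex.norm_real,
      Real.norm_eq_abs, Real.norm_eq_abs, abs_of_nonneg (by have := (hx i).1; positivity)]
    have hx0 := (hx i).1
    gcongr
    exact (hx i).2

lemma exists_exp_neg_sq_le_measure_nonneg {Ω : Type*} [MeasurableSpace Ω] {P : Measure Ω}
    [IsProbabilityMeasure P] {μ : Measure ℝ} [IsFiniteMeasure μ] {R : ℝ} (hR : 0 < R)
    (hμ : μ (Set.Icc (-R) R)ᶜ = 0) (hac : volume.withDensity (μ.rnDeriv volume) ≠ 0)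
    {f : ℝ → Ω → ℝ} (hf : ∀ x, Measurable (f x))
    (hgauss : ∀ (m : ℕ) (x : Fin m → ℝ) (a : Fin m → ℝ), ∃ v : ℝ≥0,
      P.map (fun ω => ∑ i, a i * f (x i) ω) = gaussianReal 0 v)
    (hcov : ∀ s t : ℝ, ∫ ω, f s ω * f t ω ∂P = ∫ y, Real.cos (2 * π * (s - t) * y) ∂μ) :
    ∃ C : ℝ, 0 < C ∧ ∀ L : ℝ, 1 ≤ L → ∀ (k : ℕ) (x : Fin k → ℝ), (∀ i, x i ∈ Set.Icc 0 L) →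
      ENNReal.ofReal (Real.exp (-C * L ^ 2)) ≤ P {ω | ∀ i, 0 ≤ f (x i) ω} := by
  obtain ⟨c, E, hc, hEm, hER, hE0, hE⟩ :=
    exists_measurableSet_le_of_rnDeriv_ne_zero measurableSet_Icc hμ hac
  obtain ⟨b, v, φ, hb1, hv, hφb, hφ, hinner, hsum⟩ := exists_exponential_features hR hμ
  have hb0 : 0 < b := one_pos.trans_le hb1
  set m : ℝ := (volume E).toReal / 2 with hm
  have hm0 : 0 < m := half_pos
    (ENNReal.toReal_pos hE0 ((measure_mono hER).trans_lt measure_Icc_lt_top).ne)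
  have hmR : m ≤ R := by
    have h1 := ENNReal.toReal_mono measure_Icc_lt_top.ne (measure_mono (μ := volume) hER)
    rw [Real.volume_Icc, ENNReal.toReal_ofReal (by linarith)] at h1
    linarith
  set D : ℝ := 2 * R * Real.exp 1 / m with hD
  have hD1 : 1 ≤ D := by
    rw [hD, one_le_div hm0]
    nlinarith [Real.add_one_le_exp 1]
  have hD0 : 0 < D := one_pos.trans_le hD1
  set w : ℝ := min 1 √(c * m) with hw
  have hw0 : 0 < w := lt_min one_pos (by positivity)
  have hw1 : w ≤ 1 := min_le_left _ _
  have hwc : w ≤ √(c * m) := min_le_right _ _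
  set a : ℝ := w / (4 * D) with ha
  have ha0 : 0 < a := by positivity
  have ha1 : a ≤ 1 := by rw [ha, div_le_one (by positivity)]; linarith
  set κ : ℝ := a / (8 * b) with hκ
  have hκ0 : 0 < κ := by positivity
  have hκ1 : κ ≤ 1 := by rw [hκ, div_le_one (by positivity)]; linarith
  set q : ℝ := a / (320 * b) with hq
  have hq0 : 0 < q := by positivity
  have hq1 : q < 1 := by rw [hq, div_lt_one (by positivity)]; linarith
  set A : ℝ := 2 * π * R * Real.exp 1 / κ with hA
  have hA0 : 0 < A := by positivity
  have hlog : 0 < -Real.log q := neg_pos.2 (Real.log_neg hq0 hq1)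
  refine ⟨(A + 1) ^ 2 * -Real.log q, by positivity, fun L hL k x hx => ?_⟩
  have hL0 : 0 < L := one_pos.trans_le hL
  set N : ℕ := ⌈A * L⌉₊ with hN
  have hNpos : 0 < N := Nat.ceil_pos.2 (by positivity)
  have hN1 : (1 : ℝ) ≤ N := by exact_mod_cast hNpos
  have hNA : A * L ≤ N := Nat.le_ceil _
  have hNL : (N : ℝ) ≤ (A + 1) * L := by
    have := Nat.ceil_lt_add_one (a := A * L) (by positivity)
    linarith
  have haN : a ^ N ≤ w * ((D ^ N)⁻¹ / 4) := by
    rw [ha, div_pow, mul_pow, div_le_iff₀ (by positivity)]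
    have h1 : w ^ N ≤ w := pow_le_of_le_one hw0.le hw1 hNpos.ne'
    have h2 : (4 : ℝ) ≤ 4 ^ N := le_self_pow₀ (by norm_num) hNpos.ne'
    rw [show w * ((D ^ N)⁻¹ / 4) * (4 ^ N * D ^ N) = w * (4 ^ N / 4) by field_simp]
    refine h1.trans (le_mul_of_one_le_right hw0.le ?_)
    rw [one_le_div (by norm_num)]
    exact h2
  have haN0 : 0 < a ^ N := by positivity
  have haN1 : a ^ N ≤ 1 := pow_le_one₀ ha0.le ha1
  have hκN : b * κ ^ N ≤ a ^ N / 8 := by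
    rw [hκ, div_pow, mul_div_assoc', div_le_div_iff₀ (by positivity) (by norm_num)]
    have h1 : 8 * b ≤ (8 * b) ^ N := le_self_pow₀ (by linarith) hNpos.ne'
    calc b * a ^ N * 8 = a ^ N * (8 * b) := by ring
      _ ≤ _ := by gcongr
  have htail : Real.exp (2 * π * L * R) -
      ∑ n ∈ Finset.range N, (2 * π * L * R) ^ n / n.factorial ≤ κ ^ N := by
    have he : 1 ≤ Real.exp 1 := Real.one_le_exp zero_le_one
    refine (exp_tail_le (κ := κ / Real.exp 1) (by positivity) (by positivity)
      ((div_le_one (by positivity)).2 (hκ1.trans he)) N).trans ?_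
    rw [show 2 * π * L * R / (κ / Real.exp 1) = A * L by rw [hA]; field_simp, div_pow,
      ← Real.exp_nat_mul, mul_one, div_mul_eq_mul_div, div_le_iff₀ (by positivity)]
    gcongr
  have hκθ : κ ^ N ≤ (D ^ N)⁻¹ / 4 := by
    have h1 : κ ^ N ≤ b * κ ^ N := le_mul_of_one_le_left (by positivity) hb1
    have h2 : w * ((D ^ N)⁻¹ / 4) ≤ (D ^ N)⁻¹ / 4 := mul_le_of_le_one_left (by positivity) hw1
    linarith
  obtain ⟨g, hg, hgφ⟩ := exists_inner_ge_of_convexHull (fun i => φ (x i)) haN0 (by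
    intro h hh
    obtain ⟨p, hp, hp0, hhp⟩ :=
      exists_polynomial_of_mem_convexHull hNpos.ne' hμ hL0.le htail hφ hx hh
    refine le_trans ?_ (norm_Lp_ge_of_polynomial hc hEm hER hE0 hE hm hD hD0 hp hp0 hκθ hhp)
    exact haN.trans (by gcongr))
  have hterm : ∀ n : ℕ, (2 * π * L) ^ (n + N) / (n + N).factorial * ‖v (n + N)‖ ≤
      b * ((2 * π * L * R) ^ (n + N) / (n + N).factorial) := by
    intro n
    calc _ ≤ (2 * π * L) ^ (n + N) / (n + N).factorial * (b * R ^ (n + N)) := by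
          gcongr; exact hv _
      _ = _ := by rw [mul_pow _ R]; ring
  have htsum := (hasSum_exp_tail (2 * π * L * R) N).mul_left b
  have hsm : Summable fun n : ℕ => (2 * π * L) ^ (n + N) / (n + N).factorial * ‖v (n + N)‖ :=
    Summable.of_nonneg_of_le (fun n => by positivity) hterm htsum.summable
  have key := measure_nonneg_ge_of_gram (P := P) (X := fun i => f (x i)) (fun i => hf _)
    (hgauss k x) (fun i => φ (x i)) (fun i j => (hcov _ _).trans (hinner _ _).symm)
    (v := v) (t := fun i n => (2 * π * x i) ^ n / n.factorial)
    (τ := fun n => (2 * π * L) ^ n / n.factorial) (by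
      intro i n
      have h0 := (hx i).1
      rw [abs_of_nonneg (by positivity)]
      gcongr
      exact (hx i).2) (fun i => hsum (x i)) (N := N) hsm (ε := a ^ N / 4) (by positivity) (by
      refine (hsm.tsum_le_tsum hterm htsum.summable).trans ?_
      rw [htsum.tsum_eq]
      exact (mul_le_mul_of_nonneg_left htail hb0.le).trans (by linarith)) hg (fun i => by
      rw [mul_div_cancel₀ _ (by norm_num)]; exact hgφ i) (fun i => hφb _)
    (δ := a ^ N / (4 * b * N)) (by positivity) (by
      rw [div_le_one (by positivity)]
      nlinarith [one_le_mul_of_one_le_of_one_le hb1 hN1]) (by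
      apply le_of_eq
      field_simp)
  refine le_trans (ENNReal.ofReal_le_ofReal ?_) key
  have h1 : q ^ N ≤ a ^ N / (4 * b * N) / 20 / 2 := by
    have h2 : (N : ℝ) ≤ 2 ^ N := by exact_mod_cast N.lt_two_pow_self.le
    have h3 : 160 * b ≤ (160 * b) ^ N := le_self_pow₀ (by linarith) hNpos.ne'
    have h4 : 160 * b * N ≤ (320 * b) ^ N := by
      rw [show 320 * b = 160 * b * 2 by ring, mul_pow]
      gcongr
    rw [hq, div_pow, div_div, div_div]
    gcongr
    linarith
  calc Real.exp (-((A + 1) ^ 2 * -Real.log q) * L ^ 2)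
      ≤ Real.exp ((N * N : ℕ) * Real.log q) := by
        rw [Real.exp_le_exp]
        push_cast
        have : (N : ℝ) * N ≤ ((A + 1) * L) * ((A + 1) * L) := by gcongr
        nlinarith
    _ = (q ^ N) ^ N := by rw [Real.exp_nat_mul, Real.exp_log hq0, pow_mul]
    _ ≤ (a ^ N / (4 * b * N) / 20 / 2) ^ N := by gcongr
    _ ≤ (a ^ N / (4 * b * N) / 20) ^ N / 2 := by
        rw [div_pow _ 2]
        gcongr
        exact le_self_pow₀ (by norm_num) hNpos.ne'

/-- **Corollary.** If `f` is a centered continuous stationary Gaussian process on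
`ℝ` whose spectral measure `μ` is compactly supported and has a nontrivial absolutely continuous
component (with respect to Lebesgue measure), then there exist `C' > 0` and `L₀ > 0` such that
for all `L ≥ L₀` the probability that `f ≥ 0` on `[0, L]` is at least `exp (-C' L²)`. -/
theorem positivity_probability_lower_bound_ac
    (Ω : Type) (_ : MeasurableSpace Ω) (P : Measure Ω) (hP : IsProbabilityMeasure P)
    (μ : Measure ℝ) (hfin : IsFiniteMeasure μ) (hne : μ ≠ 0)
    (hsymm : ∀ E : Set ℝ, MeasurableSet E → μ ((fun x : ℝ => -x) ⁻¹' E) = μ E)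
    (hcompact : ∃ R : ℝ, 0 < R ∧ μ (Set.Icc (-R) R)ᶜ = 0)
    (hac : volume.withDensity (μ.rnDeriv volume) ≠ 0)
    (f : ℝ → Ω → ℝ)
    (hmeas : Measurable (fun p : ℝ × Ω => f p.1 p.2))
    (hgauss : ∀ (m : ℕ) (x : Fin m → ℝ) (a : Fin m → ℝ), ∃ v : ℝ≥0,
      P.map (fun ω => ∑ i, a i * f (x i) ω) = gaussianReal 0 v)
    (hcont : ∀ᵐ ω ∂P, Continuous fun x => f x ω)
    (hcov : ∀ s t : ℝ, ∫ ω, f s ω * f t ω ∂P = ∫ y, Real.cos (2 * π * (s - t) * y) ∂μ) :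
    ∃ C' L₀ : ℝ, 0 < C' ∧ 0 < L₀ ∧
      ∀ L : ℝ, L₀ ≤ L →
        ENNReal.ofReal (Real.exp (-C' * L ^ 2)) ≤
          P {ω | ∀ x ∈ Set.Icc (0 : ℝ) L, 0 ≤ f x ω} := by
  obtain ⟨R, hR, hμ⟩ := hcompact
  obtain ⟨C, hC, hbound⟩ := exists_exp_neg_sq_le_measure_nonneg (P := P) (f := f) hR hμ hac
    (fun x => hmeas.comp measurable_prodMk_left) hgauss hcov
  refine ⟨C, 1, hC, one_pos, fun L hL => ?_⟩
  have : Nonempty (Set.Icc 0 L) := ⟨⟨0, le_rfl, zero_le_one.trans hL⟩⟩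
  set d := TopologicalSpace.denseSeq (Set.Icc 0 L)
  have hanti : Antitone fun k : ℕ => {ω | ∀ i : Fin k, 0 ≤ f (d i) ω} := by
    intro k l hkl ω hω i
    exact hω (Fin.castLE hkl i)
  have hms : ∀ k : ℕ, MeasurableSet {ω | ∀ i : Fin k, 0 ≤ f (d i) ω} := by
    intro k
    rw [Set.ofPred_forall]
    exact MeasurableSet.iInter fun i => measurableSet_le measurable_const
      (hmeas.comp measurable_prodMk_left)
  have hlim := tendsto_measure_iInter_atTop (μ := P) (fun k => (hms k).nullMeasurableSet) hanti
    ⟨0, measure_ne_top _ _⟩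
  refine (ge_of_tendsto' hlim fun k => hbound L hL k _ fun i => (d i).2).trans
    (measure_mono_ae ?_)
  filter_upwards [hcont] with ω hω hall x hx
  have hclosed : IsClosed {y : Set.Icc 0 L | 0 ≤ f y ω} :=
    isClosed_le continuous_const (hω.comp continuous_subtype_val)
  have hsub : Set.range d ⊆ {y : Set.Icc 0 L | 0 ≤ f y ω} := by
    rintro _ ⟨n, rfl⟩
    exact Set.mem_iInter.1 hall (n + 1) (Fin.last n)
  exact (TopologicalSpace.denseRange_denseSeq (Set.Icc 0 L)).closure_eq.symm.subset.trans
    (closure_minimal hsub hclosed) (Set.mem_univ (⟨x, hx⟩ : Set.Icc 0 L))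
end

section
/- Let K ≥ 1 and let F be a centered Gaussian random vector in ℝ^K whose covariance matrix has all diagonal entries at most 1 (i.e., E[Fₖ²] ≤ 1 for each k). Then for every α with 0 < α ≤ 1, the probability that the Euclidean norm |F| is at most α is at least (α/(3K))^K. -/
open MeasureTheory ProbabilityTheory
open scoped NNReal

/-- Mass of a centered interval under a centered Gaussian of variance at most `s ^ 2`. -/
lemma gaussianReal_Icc_lower_bound {v : ℝ≥0} {s t : ℝ} (hs : 0 < s) (hvs : (v : ℝ) ≤ s ^ 2)
    (ht : 0 ≤ t) (ht1 : t ≤ 1) :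
    ENNReal.ofReal (t / 3) ≤ gaussianReal 0 v (Set.Icc (-(t * s)) (t * s)) := by
  have hts : 0 ≤ t * s := by positivity
  rcases eq_or_ne v 0 with rfl | hv
  · rw [gaussianReal_zero_var, Measure.dirac_apply_of_mem (by simpa using hts)]
    exact ENNReal.ofReal_le_one.2 (by linarith)
  have hv0 : (0 : ℝ) < v := by positivity
  set r := t * √v with hr
  have hr0 : 0 ≤ r := by positivity
  have hrs : r ≤ t * s := mul_le_mul_of_nonneg_left ((Real.sqrt_le_left hs.le).2 hvs) ht
  have hsub : Set.Icc (-r) r ⊆ Set.Icc (-(t * s)) (t * s) :=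
    Set.Icc_subset_Icc (neg_le_neg hrs) hrs
  have hpi : √(2 * Real.pi) ≤ 3 := by
    rw [Real.sqrt_le_left (by norm_num)]
    linarith [Real.pi_lt_four]
  have hpdf : ∀ x ∈ Set.Icc (-r) r, 1 / (6 * √v) ≤ gaussianPDFReal 0 v x := by
    intro x hx
    have hx2 : x ^ 2 ≤ v := by
      calc x ^ 2 ≤ r ^ 2 := sq_le_sq' hx.1 hx.2
        _ = t ^ 2 * v := by rw [hr, mul_pow, Real.sq_sqrt hv0.le]
        _ ≤ 1 * v := by gcongr; exact pow_le_one₀ ht ht1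
        _ = v := one_mul _
    have hexp : (1 : ℝ) / 2 ≤ Real.exp (-(x - 0) ^ 2 / (2 * v)) := by
      have h1 : -(1 / 2 : ℝ) ≤ -(x - 0) ^ 2 / (2 * v) := by
        rw [le_div_iff₀ (by positivity)]
        linarith [sub_zero x ▸ hx2]
      linarith [Real.add_one_le_exp (-(x - 0) ^ 2 / (2 * v))]
    have hconst : 1 / (3 * √v) ≤ (√(2 * Real.pi * v))⁻¹ := by
      rw [Real.sqrt_mul (by positivity), ← one_div]
      gcongr
    calc 1 / (6 * √v) = 1 / (3 * √v) * (1 / 2) := by field_simp; norm_num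
      _ ≤ _ := by exact mul_le_mul hconst hexp (by norm_num) (by positivity)
  calc ENNReal.ofReal (t / 3)
      = ENNReal.ofReal (1 / (6 * √v)) * volume (Set.Icc (-r) r) := by
        rw [Real.volume_Icc, ← ENNReal.ofReal_mul (by positivity)]
        congr 1
        rw [hr]
        field_simp
        ring
    _ = ∫⁻ _ in Set.Icc (-r) r, ENNReal.ofReal (1 / (6 * √v)) := (setLIntegral_const _ _).symm
    _ ≤ ∫⁻ x in Set.Icc (-r) r, gaussianPDF 0 v x :=
        setLIntegral_mono' measurableSet_Icc fun x hx => ENNReal.ofReal_le_ofReal (hpdf x hx)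
    _ = gaussianReal 0 v (Set.Icc (-r) r) := (gaussianReal_apply 0 hv _).symm
    _ ≤ _ := measure_mono hsub

/-- If all linear combinations of the coordinates of `F` are Gaussian, then every linear image of
`F` is a Gaussian vector. -/
lemma hasGaussianLaw_linear_image {ι κ Ω : Type*} [Fintype ι] [Fintype κ] [MeasurableSpace Ω]
    {P : Measure Ω} {F : Ω → ι → ℝ}
    (hF : ∀ i, AEMeasurable (fun ω => F ω i) P)
    (hgauss : ∀ c : ι → ℝ, ∃ v : ℝ≥0, P.map (fun ω => ∑ i, c i * F ω i) = gaussianReal 0 v)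
    (b : κ → ι → ℝ) :
    HasGaussianLaw (fun ω k => ∑ i, b k i * F ω i) P where
  isGaussian_map := by
    classical
    refine isGaussian_of_map_eq_gaussianReal fun L => ?_
    obtain ⟨v, hv⟩ := hgauss fun i => ∑ k, L (Pi.single k 1) * b k i
    refine ⟨0, v, ?_⟩
    rw [AEMeasurable.map_map_of_aemeasurable (by fun_prop) (by fun_prop), ← hv]
    congr 1
    ext ω
    have hL : ∀ y : κ → ℝ, L y = ∑ k, L (Pi.single k 1) * y k := by
      intro y
      conv_lhs => rw [pi_eq_sum_univ' y]
      simp [map_sum, mul_comm]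
    simp only [Function.comp_apply]
    rw [hL]
    simp only [Finset.mul_sum, Finset.sum_mul]
    rw [Finset.sum_comm]
    simp only [mul_assoc]

/-- Second moments of linear combinations, in terms of the second moment matrix. -/
lemma integral_linear_mul_linear {ι Ω : Type*} [Fintype ι] [MeasurableSpace Ω]
    {P : Measure Ω} {F : Ω → ι → ℝ} (hF : ∀ i, MemLp (fun ω => F ω i) 2 P) (c d : ι → ℝ) :
    ∫ ω, (∑ i, c i * F ω i) * (∑ i, d i * F ω i) ∂P =
      c ⬝ᵥ (Matrix.of fun i j => ∫ ω, F ω i * F ω j ∂P).mulVec d := by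
  have hint : ∀ i j, Integrable (fun ω => c i * F ω i * (d j * F ω j)) P := fun i j =>
    ((hF i).const_mul (c i)).integrable_mul ((hF j).const_mul (d j))
  simp only [Finset.sum_mul_sum]
  rw [integral_finsetSum _ fun i _ => integrable_finsetSum _ fun j _ => hint i j]
  simp only [dotProduct, Matrix.mulVec, Matrix.of_apply, Finset.mul_sum]
  refine Finset.sum_congr rfl fun i _ => ?_
  rw [integral_finsetSum _ fun j _ => hint i j]
  refine Finset.sum_congr rfl fun j _ => ?_
  rw [← integral_mul_const, ← integral_const_mul]
  congr 1
  ext ω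
  ring

/-- If `F` is a centered Gaussian random vector in `ℝ^K` (`K ≥ 1`) whose
covariance matrix has all diagonal entries at most `1`, then for every `0 < α ≤ 1` the
probability that the Euclidean norm of `F` is at most `α` is at least `(α/(3K))^K`. -/
theorem gaussian_vector_small_ball_lower_bound (K : ℕ) (hK : 1 ≤ K)
    (Ω : Type) (_ : MeasurableSpace Ω) (P : Measure Ω) (hP : IsProbabilityMeasure P)
    (F : Ω → Fin K → ℝ)
    (hgauss : ∀ c : Fin K → ℝ, ∃ v : ℝ≥0,
      P.map (fun ω => ∑ i, c i * F ω i) = gaussianReal 0 v)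
    (hdiag : ∀ k : Fin K, ∫ ω, (F ω k) ^ 2 ∂P ≤ 1)
    (α : ℝ) (hα : 0 < α) (hα1 : α ≤ 1) :
    ENNReal.ofReal ((α / (3 * K)) ^ K) ≤
      P {ω | Real.sqrt (∑ i, (F ω i) ^ 2) ≤ α} := by
  have hcoord : ∀ k, HasGaussianLaw (fun ω => F ω k) P := fun k => by
    obtain ⟨v, hv⟩ := hgauss (Pi.single k 1)
    simp only [Pi.single_apply, ite_mul, one_mul, zero_mul, Finset.sum_ite_eq',
      Finset.mem_univ, if_true] at hv
    exact ⟨hv ▸ inferInstance⟩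
  have hmeas : ∀ k, AEMeasurable (fun ω => F ω k) P := fun k => (hcoord k).aemeasurable
  have hL2 : ∀ k, MemLp (fun ω => F ω k) 2 P := fun k => (hcoord k).memLp_two
  have hS : (Matrix.of fun i j => ∫ ω, F ω i * F ω j ∂P).IsHermitian := by
    ext i j
    simp [Matrix.conjTranspose_apply, mul_comm]
  set b := hS.eigenvectorBasis with hb
  set Y : Fin K → Ω → ℝ := fun i ω => ∑ j, b i j * F ω j with hY
  have hYinner : ∀ i ω, Y i ω = inner ℝ (b i) (WithLp.toLp 2 (F ω)) := fun i ω => by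
    simp [hY, PiLp.inner_apply, mul_comm]
  have hYsum : ∀ ω, ∑ i, Y i ω ^ 2 = ∑ i, F ω i ^ 2 := fun ω => by
    simp only [hYinner]
    rw [b.sum_sq_inner_right, EuclideanSpace.real_norm_sq_eq]
  have hYlaw : HasGaussianLaw (fun ω => (Y · ω)) P :=
    hasGaussianLaw_linear_image hmeas hgauss fun i j => b i j
  have hYL2 : ∀ i, MemLp (Y i) 2 P := fun i => (hYlaw.eval i).memLp_two
  have hmap : ∀ i, ∃ v : ℝ≥0, P.map (Y i) = gaussianReal 0 v := fun i => hgauss (b i)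
  have hmean : ∀ i, ∫ ω, Y i ω ∂P = 0 := fun i => by
    obtain ⟨v, hv⟩ := hmap i
    rw [← integral_id_gaussianReal (μ := 0) (v := v), ← hv,
      integral_map (hYlaw.eval i).aemeasurable (by fun_prop)]
  have hindep : iIndepFun Y P := by
    refine hYlaw.iIndepFun_of_covariance_eq_zero fun i j hij => ?_
    rw [covariance_eq_sub (hYL2 i) (hYL2 j), hmean, zero_mul, sub_zero]
    refine (integral_linear_mul_linear hL2 (b i) (b j)).trans ?_
    rw [hb, hS.mulVec_eigenvectorBasis, dotProduct_smul]
    have := b.orthonormal.2 hij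
    simp only [PiLp.inner_apply, RCLike.inner_apply, conj_trivial] at this
    simp only [dotProduct, smul_eq_mul]
    rw [mul_eq_zero]
    exact Or.inr (by simpa [mul_comm] using this)
  have hsecond : ∀ i, ∫ ω, Y i ω ^ 2 ∂P ≤ K := fun i => by
    calc ∫ ω, Y i ω ^ 2 ∂P ≤ ∫ ω, ∑ k, F ω k ^ 2 ∂P := by
          refine integral_mono (hYL2 i).integrable_sq
            (integrable_finsetSum _ fun k _ => (hL2 k).integrable_sq) fun ω => ?_
          simp only [← hYsum]
          exact Finset.single_le_sum (f := fun i => Y i ω ^ 2) (fun _ _ => sq_nonneg _)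
            (Finset.mem_univ i)
      _ = ∑ k, ∫ ω, F ω k ^ 2 ∂P := integral_finsetSum _ fun k _ => (hL2 k).integrable_sq
      _ ≤ ∑ _k : Fin K, (1 : ℝ) := Finset.sum_le_sum fun k _ => hdiag k
      _ = K := by simp
  have hK0 : (0 : ℝ) < K := by exact_mod_cast hK
  set a := α / K * √K with ha
  have ha0 : 0 ≤ a := by positivity
  have hone : ∀ i, ENNReal.ofReal (α / (3 * K)) ≤ P (Y i ⁻¹' Set.Icc (-a) a) := fun i => by
    obtain ⟨v, hv⟩ := hmap i
    have hvK : (v : ℝ) ≤ √K ^ 2 := by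
      rw [Real.sq_sqrt hK0.le, ← variance_id_gaussianReal (μ := 0) (v := v), ← hv,
        variance_map aemeasurable_id (hYlaw.eval i).aemeasurable, Function.id_comp,
        variance_of_integral_eq_zero (hYlaw.eval i).aemeasurable (hmean i)]
      exact hsecond i
    rw [← Measure.map_apply_of_aemeasurable (hYlaw.eval i).aemeasurable measurableSet_Icc, hv]
    convert gaussianReal_Icc_lower_bound (Real.sqrt_pos.2 hK0) hvK (by positivity : 0 ≤ α / K)
      (div_le_one_of_le₀ (hα1.trans (by exact_mod_cast hK)) hK0.le) using 2
    field_simp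
  calc ENNReal.ofReal ((α / (3 * K)) ^ K)
      = ∏ _i : Fin K, ENNReal.ofReal (α / (3 * K)) := by
        rw [ENNReal.ofReal_pow (by positivity)]; simp
    _ ≤ ∏ i, P (Y i ⁻¹' Set.Icc (-a) a) := Finset.prod_le_prod' fun i _ => hone i
    _ = P (⋂ i ∈ Finset.univ, Y i ⁻¹' Set.Icc (-a) a) :=
        (hindep.measure_inter_preimage_eq_mul Finset.univ fun _ _ => measurableSet_Icc).symm
    _ ≤ _ := measure_mono fun ω hω => by
        simp only [Finset.mem_univ, Set.iInter_true, Set.mem_iInter, Set.mem_preimage,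
          Set.mem_Icc] at hω
        rw [Set.mem_ofPred_eq, Real.sqrt_le_left hα.le, ← hYsum]
        calc ∑ i, Y i ω ^ 2 ≤ ∑ _i : Fin K, a ^ 2 :=
              Finset.sum_le_sum fun i _ => sq_le_sq' (hω i).1 (hω i).2
          _ = α ^ 2 := by
              simp only [Finset.sum_const, Finset.card_univ, Fintype.card_fin, nsmul_eq_mul, ha,
                mul_pow, Real.sq_sqrt hK0.le]
              field_simp
end
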